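/- Invariance of the degenerate covariant metric under the second Poincaré algebra: let U = {x ∈ ℝ⁴ : x·x ≠ 0} and define g_{μν}(x) = (x_μ x_ν − (x·x) η_{μν})/(x·x)² on U. Then for every 𝔭₂ vector field ξ(x) = A x + (b·x) x (with A ∈ 𝔰𝔬(1,3) and b ∈ ℝ⁴), the Lie derivative of g along ξ vanishes on U: ξ^λ ∂_λ g_{μν} + g_{μλ} ∂_ν ξ^λ + g_{λν} ∂_μ ξ^λ = 0 for all μ, ν. -/

import Mathlib

noncomputable section

open scoped BigOperators

/-- The Minkowski metric η = diag(1,−1,−1,−1), as a function of two indices. -/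
def etaF : Fin 4 → Fin 4 → ℝ := fun μ ν => if μ = ν then (if μ = 0 then 1 else -1) else 0

/-- The Minkowski product x·y = η_{μν} x^μ y^ν. -/
def mdot (x y : Fin 4 → ℝ) : ℝ := ∑ μ, ∑ ν, etaF μ ν * x μ * y ν

/-- The lowered index x_μ = η_{μν} x^ν. -/
def lowr (x : Fin 4 → ℝ) (μ : Fin 4) : ℝ := ∑ ν, etaF μ ν * x ν

/-- The partial derivative ∂_λ f (x). -/
def pdv (f : (Fin 4 → ℝ) → ℝ) (lam : Fin 4) (x : Fin 4 → ℝ) : ℝ :=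
  fderiv ℝ f x (Pi.single lam 1)

/-- A ∈ 𝔰𝔬(1,3), i.e. Aᵀη + ηA = 0, written componentwise. -/
def so13 (A : Fin 4 → Fin 4 → ℝ) : Prop :=
  ∀ μ ν, (∑ κ, A κ μ * etaF κ ν) + (∑ κ, etaF μ κ * A κ ν) = 0

/-- The 𝔭₂ vector field ξ(x) = A x + (b·x) x. -/
def xiP2 (A : Fin 4 → Fin 4 → ℝ) (b : Fin 4 → ℝ) (x : Fin 4 → ℝ) : Fin 4 → ℝ :=
  fun μ => (∑ ν, A μ ν * x ν) + mdot b x * x μ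

/-- Lie derivative of a covariant symmetric 2-tensor field g along a vector field ξ:
  (ℒ_ξ g)_{μν} = ξ^λ ∂_λ g_{μν} + g_{μλ} ∂_ν ξ^λ + g_{λν} ∂_μ ξ^λ. -/
def lieG (ξf : (Fin 4 → ℝ) → Fin 4 → ℝ) (g : (Fin 4 → ℝ) → Fin 4 → Fin 4 → ℝ)
    (x : Fin 4 → ℝ) (μ ν : Fin 4) : ℝ :=
  (∑ lam, ξf x lam * pdv (fun y => g y μ ν) lam x)
  + (∑ lam, g x μ lam * pdv (fun y => ξf y lam) ν x)
  + (∑ lam, g x lam ν * pdv (fun y => ξf y lam) μ x)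

/-- Lie derivative of a contravariant symmetric 2-tensor field h along a vector field ξ:
  (ℒ_ξ h)^{μν} = ξ^λ ∂_λ h^{μν} − h^{μλ} ∂_λ ξ^ν − h^{λν} ∂_λ ξ^μ. -/
def lieH (ξf : (Fin 4 → ℝ) → Fin 4 → ℝ) (h : (Fin 4 → ℝ) → Fin 4 → Fin 4 → ℝ)
    (x : Fin 4 → ℝ) (μ ν : Fin 4) : ℝ :=
  (∑ lam, ξf x lam * pdv (fun y => h y μ ν) lam x)
  - (∑ lam, h x μ lam * pdv (fun y => ξf y ν) lam x)
  - (∑ lam, h x lam ν * pdv (fun y => ξf y μ) lam x)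

/-- Lie derivative of a connection Γ^μ_{νρ} along a vector field ξ ([ℒ_ξ, ∇]):
  ξ^λ ∂_λ Γ^μ_{νρ} − Γ^λ_{νρ} ∂_λ ξ^μ + Γ^μ_{λρ} ∂_ν ξ^λ + Γ^μ_{νλ} ∂_ρ ξ^λ + ∂_ν ∂_ρ ξ^μ. -/
def lieConn (ξf : (Fin 4 → ℝ) → Fin 4 → ℝ)
    (Γ : (Fin 4 → ℝ) → Fin 4 → Fin 4 → Fin 4 → ℝ)
    (x : Fin 4 → ℝ) (μ ν ρ : Fin 4) : ℝ :=
  (∑ lam, ξf x lam * pdv (fun y => Γ y μ ν ρ) lam x)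
  - (∑ lam, Γ x lam ν ρ * pdv (fun y => ξf y μ) lam x)
  + (∑ lam, Γ x μ lam ρ * pdv (fun y => ξf y lam) ν x)
  + (∑ lam, Γ x μ ν lam * pdv (fun y => ξf y lam) ρ x)
  + pdv (fun y => pdv (fun z => ξf z μ) ρ y) ν x

/-- The canonical degenerate covariant metric g_{μν}(x) = (x_μ x_ν − (x·x) η_{μν})/(x·x)². -/
def gC (x : Fin 4 → ℝ) (μ ν : Fin 4) : ℝ :=
  (lowr x μ * lowr x ν - mdot x x * etaF μ ν) / (mdot x x) ^ 2

/-- The canonical degenerate contravariant metric h^{μν}(x) = (x·x) x^μ x^ν. -/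
def hC (x : Fin 4 → ℝ) (μ ν : Fin 4) : ℝ := mdot x x * x μ * x ν

/-- The canonical connection Γ^μ_{νλ}(x) = −(x_ν δ^μ_λ + δ^μ_ν x_λ)/(x·x). -/
def GammaC (x : Fin 4 → ℝ) (μ ν lam : Fin 4) : ℝ :=
  -(lowr x ν * (if μ = lam then 1 else 0) + (if μ = ν then 1 else 0) * lowr x lam) / mdot x x

/-- Diagonal entries of the Minkowski metric. -/
def eD (μ : Fin 4) : ℝ := if μ = 0 then 1 else -1

lemma lowr_eq (x : Fin 4 → ℝ) (μ : Fin 4) : lowr x μ = eD μ * x μ := by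
  simp [lowr, etaF, eD]

lemma mdot_eq (x y : Fin 4 → ℝ) : mdot x y = ∑ μ, eD μ * x μ * y μ := by
  simp [mdot, etaF, eD]

lemma so13_eq {A : Fin 4 → Fin 4 → ℝ} (hA : so13 A) (μ ν : Fin 4) :
    eD μ * A μ ν = - (eD ν * A ν μ) := by
  have h := hA μ ν
  have h1 : (∑ κ, A κ μ * etaF κ ν) = eD ν * A ν μ := by
    rw [Finset.sum_eq_single ν]
    · simp [etaF, eD]
    · intro k _ hk
      simp [etaF, hk]
    · simp
  have h2 : (∑ κ, etaF μ κ * A κ ν) = eD μ * A μ ν := by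
    simp [etaF, eD]
  rw [h1, h2] at h
  linarith

lemma sum_pdv (f : (Fin 4 → ℝ) → ℝ) (x v : Fin 4 → ℝ) :
    ∑ lam, v lam * pdv f lam x = fderiv ℝ f x v := by
  conv_rhs => rw [pi_eq_sum_univ' v, map_sum]
  refine Finset.sum_congr rfl fun i _ => ?_
  rw [map_smul, smul_eq_mul, pdv]

lemma coord_deriv (x : Fin 4 → ℝ) (i : Fin 4) :
    HasFDerivAt (fun y : Fin 4 → ℝ => y i) (ContinuousLinearMap.proj (R := ℝ) (φ := fun _ : Fin 4 => ℝ) i) x :=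
  hasFDerivAt_apply i x

lemma mdot_deriv (x : Fin 4 → ℝ) :
    ∃ Q : (Fin 4 → ℝ) →L[ℝ] ℝ, HasFDerivAt (fun y => mdot y y) Q x ∧ ∀ v, Q v = 2 * mdot x v := by
  have h : HasFDerivAt (fun y : Fin 4 → ℝ => ∑ μ, eD μ * (y μ * y μ)) _ x :=
    HasFDerivAt.fun_sum (u := Finset.univ)
      fun i _ => ((coord_deriv x i).mul (coord_deriv x i)).const_mul (eD i)
  have e : (fun y : Fin 4 → ℝ => mdot y y) = fun y => ∑ μ, eD μ * (y μ * y μ) := by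
    funext y
    rw [mdot_eq]
    exact Finset.sum_congr rfl fun i _ => by ring
  rw [← e] at h
  refine ⟨_, h, ?_⟩
  · intro v
    rw [mdot_eq, Finset.mul_sum, ContinuousLinearMap.sum_apply]
    refine Finset.sum_congr rfl fun i _ => ?_
    simp
    ring

lemma gC_deriv (x : Fin 4 → ℝ) (hx : mdot x x ≠ 0) (μ ν : Fin 4) (v : Fin 4 → ℝ) :
    fderiv ℝ (fun y => gC y μ ν) x v =
      (lowr v μ * lowr x ν + lowr x μ * lowr v ν - 2 * mdot x v * etaF μ ν) / (mdot x x) ^ 2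
      - 4 * mdot x v * (lowr x μ * lowr x ν - mdot x x * etaF μ ν) / (mdot x x) ^ 3 := by
  obtain ⟨Q, hQ, hQv⟩ := mdot_deriv x
  have hl : ∀ i, HasFDerivAt (fun y : Fin 4 → ℝ => lowr y i) _ x := fun i => by
    simp only [lowr_eq]
    exact (coord_deriv x i).const_mul (eD i)
  have hn := ((hl μ).mul (hl ν)).sub (hQ.mul_const (etaF μ ν))
  have hinv := (hasDerivAt_inv (pow_ne_zero 2 hx)).comp_hasFDerivAt x (hQ.pow 2)
  have h := hn.mul hinv
  have h' : HasFDerivAt (fun y => gC y μ ν) _ x := h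
  rw [h'.fderiv]
  simp [hQv, lowr_eq]
  field_simp
  ring

lemma xi_deriv (A : Fin 4 → Fin 4 → ℝ) (b x : Fin 4 → ℝ) (lam ν : Fin 4) :
    pdv (fun y => xiP2 A b y lam) ν x =
      A lam ν + eD ν * b ν * x lam + mdot b x * (if lam = ν then 1 else 0) := by
  have h1 : HasFDerivAt (fun y : Fin 4 → ℝ => ∑ i, A lam i * y i) _ x :=
    HasFDerivAt.fun_sum (u := Finset.univ) fun i _ => (coord_deriv x i).const_mul (A lam i)
  have h2 : HasFDerivAt (fun y : Fin 4 → ℝ => ∑ i, eD i * b i * y i) _ x :=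
    HasFDerivAt.fun_sum (u := Finset.univ) fun i _ => (coord_deriv x i).const_mul (eD i * b i)
  have h := h1.add (h2.mul (coord_deriv x lam))
  have e : (fun y => xiP2 A b y lam) =
      (fun y : Fin 4 → ℝ => ∑ i, A lam i * y i) +
        (fun y : Fin 4 → ℝ => ∑ i, eD i * b i * y i) * (fun y => y lam) := by
    funext y
    simp [xiP2, mdot_eq]
  rw [pdv, e, h.fderiv]
  simp [Pi.single_apply, mdot_eq]
  ring

lemma gC_symm (x : Fin 4 → ℝ) (μ ν : Fin 4) : gC x μ ν = gC x ν μ := by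
  have : etaF μ ν = etaF ν μ := by
    by_cases h : μ = ν
    · rw [h]
    · simp [etaF, h, Ne.symm h]
  rw [gC, gC, this, mul_comm (lowr x μ)]

lemma gC_ker (x : Fin 4 → ℝ) (μ : Fin 4) : ∑ lam, gC x μ lam * x lam = 0 := by
  have h : ∀ lam, gC x μ lam * x lam =
      (lowr x μ * (eD lam * x lam * x lam) - mdot x x * (etaF μ lam * x lam)) / (mdot x x) ^ 2 := by
    intro lam
    rw [gC, lowr_eq x lam]
    ring
  simp only [h]
  rw [← Finset.sum_div, Finset.sum_sub_distrib, ← Finset.mul_sum, ← Finset.mul_sum, ← mdot_eq]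
  change (lowr x μ * mdot x x - mdot x x * lowr x μ) / _ = 0
  rw [mul_comm, sub_self, zero_div]

lemma gC_A {A : Fin 4 → Fin 4 → ℝ} (hA : so13 A) (x : Fin 4 → ℝ) (μ ν : Fin 4) :
    ∑ lam, gC x μ lam * A lam ν =
      (- (lowr x μ * (eD ν * ∑ i, A ν i * x i)) - mdot x x * (eD μ * A μ ν)) / (mdot x x) ^ 2 := by
  have h : ∀ lam, gC x μ lam * A lam ν =
      (- (lowr x μ * (eD ν * (A ν lam * x lam))) - mdot x x * (etaF μ lam * A lam ν))
        / (mdot x x) ^ 2 := by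
    intro lam
    rw [gC, lowr_eq x lam]
    have := so13_eq hA lam ν
    linear_combination lowr x μ * x lam / (mdot x x) ^ 2 * this
  have h2 : (∑ κ, etaF μ κ * A κ ν) = eD μ * A μ ν := by
    simp [etaF, eD]
  simp only [h]
  rw [← Finset.sum_div, Finset.sum_sub_distrib, Finset.sum_neg_distrib, ← Finset.mul_sum,
    ← Finset.mul_sum, ← Finset.mul_sum, h2]

lemma second_term {A : Fin 4 → Fin 4 → ℝ} (hA : so13 A) (b x : Fin 4 → ℝ) (μ ν : Fin 4) :
    ∑ lam, gC x μ lam * pdv (fun y => xiP2 A b y lam) ν x =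
      (- (lowr x μ * (eD ν * ∑ i, A ν i * x i)) - mdot x x * (eD μ * A μ ν)) / (mdot x x) ^ 2
      + mdot b x * gC x μ ν := by
  have h : ∀ lam, gC x μ lam * pdv (fun y => xiP2 A b y lam) ν x =
      gC x μ lam * A lam ν + eD ν * b ν * (gC x μ lam * x lam)
        + mdot b x * (gC x μ lam * (if lam = ν then 1 else 0)) := by
    intro lam
    rw [xi_deriv]
    ring
  simp only [h]
  rw [Finset.sum_add_distrib, Finset.sum_add_distrib, ← Finset.mul_sum, ← Finset.mul_sum,
    gC_ker, gC_A hA]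
  simp

lemma mdot_A {A : Fin 4 → Fin 4 → ℝ} (hA : so13 A) (x : Fin 4 → ℝ) :
    ∑ i, eD i * x i * ∑ j, A i j * x j = 0 := by
  have h : ∑ i, eD i * x i * ∑ j, A i j * x j = - ∑ i, eD i * x i * ∑ j, A i j * x j := by
    simp only [Finset.mul_sum]
    conv_lhs => rw [Finset.sum_comm]
    simp only [← Finset.sum_neg_distrib]
    refine Finset.sum_congr rfl fun i _ => Finset.sum_congr rfl fun j _ => ?_
    linear_combination x i * x j * so13_eq hA j i
  linarith

lemma mdot_xi {A : Fin 4 → Fin 4 → ℝ} (hA : so13 A) (b x : Fin 4 → ℝ) :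
    mdot x (xiP2 A b x) = mdot b x * mdot x x := by
  rw [mdot_eq x (xiP2 A b x), mdot_eq x x]
  simp only [xiP2, mul_add, Finset.sum_add_distrib]
  rw [mdot_A hA, zero_add, Finset.mul_sum]
  exact Finset.sum_congr rfl fun i _ => by ring

/-- Invariance of the degenerate covariant metric g_{μν} under the second Poincaré algebra. -/
theorem stmt_7 (A : Fin 4 → Fin 4 → ℝ) (hA : so13 A) (b : Fin 4 → ℝ) :
    ∀ x : Fin 4 → ℝ, mdot x x ≠ 0 → ∀ μ ν, lieG (xiP2 A b) gC x μ ν = 0 := by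
  intro x hx μ ν
  have h3 : ∀ lam, gC x lam ν = gC x ν lam := fun lam => gC_symm x lam ν
  rw [lieG, sum_pdv (fun y => gC y μ ν), gC_deriv x hx, second_term hA]
  simp only [h3]
  rw [second_term hA, gC_symm x ν μ, mdot_xi hA, so13_eq hA μ ν, lowr_eq (xiP2 A b x), lowr_eq (xiP2 A b x)]
  simp only [xiP2, gC]
  have e1 := lowr_eq x μ
  have e2 := lowr_eq x ν
  rw [mul_add (eD μ), mul_add (eD ν), mul_left_comm (eD μ) (mdot b x), mul_left_comm (eD ν) (mdot b x),
    ← e1, ← e2]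
  field_simp
  ring
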